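/- For nonnegative integers M and N, with |q| < 1 and q not a root of unity, setting a = q^{M+2} and b = q^{-2N}, the terminating series ${}_2\phi_1(q^{M+2}, q^{-2N}; q^{-2N+1-M-2}; q, -q^{-M-1})$, i.e. $\sum_{i=0}^{2N} \frac{(q^{M+2};q)_i (q^{-2N};q)_i}{(q;q)_i (q^{-2N-M-1};q)_i} (-q^{-M-1})^i$, equals $\frac{(-q^{M+2};q)_N (q; q^2)_N}{(q^{M+N+2}; q)_N}$. -/

import Mathlib

open Finset

noncomputable def qPoch (a q : ℂ) (n : ℕ) : ℂ := ∏ j ∈ Finset.range n, (1 - a * q ^ j)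

noncomputable def qPochInf (a q : ℂ) : ℂ := ∏' j : ℕ, (1 - a * q ^ j)

noncomputable def phi (a b c q x : ℂ) : ℂ :=
  ∑' i : ℕ, qPoch a q i * qPoch b q i / (qPoch q q i * qPoch c q i) * x ^ i

theorem qP_succ (a q : ℂ) (n : ℕ) : qPoch a q (n+1) = qPoch a q n * (1 - a * q ^ n) := by
  simp [qPoch, Finset.prod_range_succ]

theorem qP_zero (a q : ℂ) : qPoch a q 0 = 1 := by simp [qPoch]

theorem qP_add (a q : ℂ) (m n : ℕ) : qPoch a q (m+n) = qPoch a q m * qPoch (a * q ^ m) q n := by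
  induction n with
  | zero => simp [qP_zero]
  | succ n ih => rw [← add_assoc, qP_succ, ih, qP_succ]; ring

theorem qP_sq (a q : ℂ) (n : ℕ) : qPoch (a^2) (q^2) n = qPoch a q n * qPoch (-a) q n := by
  induction n with
  | zero => simp [qP_zero]
  | succ n ih => rw [qP_succ, ih, qP_succ, qP_succ]; ring

theorem qP_two (q : ℂ) (n : ℕ) :
    qPoch q q (2 * n) = qPoch q (q^2) n * qPoch (q^2) (q^2) n := by
  induction n with
  | zero => simp [qP_zero]
  | succ n ih =>
    rw [show 2 * (n+1) = 2 * n + 1 + 1 by ring, qP_succ, qP_succ, ih, qP_succ, qP_succ]; ring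

theorem qP_term (q A B C x : ℂ) (n : ℕ) (hq0 : q ≠ 0) (hA : A ≠ 0)
    (hroot : ∀ n : ℕ, 0 < n → q ^ n ≠ 1)
    (hB : B * q ^ n = 1) (hC : A * C * q ^ n = q) (hx : x * A = - q) (i m : ℕ) (h : i + m = n) :
    qPoch B q i * x ^ i * qPoch A q n * qPoch q q m =
      (-1) ^ i * qPoch q q n * qPoch A q m * qPoch C q i := by
  induction i generalizing m with
  | zero =>
    obtain rfl : m = n := by omega
    simp [qP_zero]; ring
  | succ i ih =>
    have h1 := ih (m+1) (by omega)
    rw [qP_succ q q, qP_succ A q m] at h1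
    have hne : (1 - q * q ^ m) ≠ 0 := by
      have := hroot (m+1) (by omega)
      intro h0
      apply this
      rw [pow_succ]; linear_combination -h0
    have hqm : q ^ m ≠ 0 := pow_ne_zero _ hq0
    have hqi : q ^ i ≠ 0 := pow_ne_zero _ hq0
    have hn : q ^ n = q ^ i * q * q ^ m := by rw [← h]; ring
    rw [hn] at hB hC
    have key : (1 - B * q ^ i) * x * (1 - A * q ^ m) = - ((1 - C * q ^ i) * (1 - q * q ^ m)) := by
      have e1 : B = 1 / (q ^ i * q * q ^ m) := by field_simp; linear_combination hB
      have e2 : C = 1 / (A * q ^ i * q ^ m) := by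
        field_simp
        apply mul_left_cancel₀ hq0
        linear_combination hC
      have e3 : x = - q / A := by field_simp; linear_combination hx
      rw [e1, e2, e3]; field_simp; ring
    apply mul_right_cancel₀ hne
    rw [qP_succ, qP_succ, pow_succ, pow_succ]
    linear_combination (1 - B * q ^ i) * x * h1 +
      (-1) ^ i * qPoch q q n * qPoch A q m * qPoch C q i * key

open PowerSeries in
theorem qP_conv (q A : ℂ) (hroot : ∀ n : ℕ, 0 < n → q ^ n ≠ 1) (N : ℕ) :
    ∑ i ∈ Finset.range (2 * N + 1), (-1) ^ i * (qPoch A q i / qPoch q q i) *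
      (qPoch A q (2 * N - i) / qPoch q q (2 * N - i)) =
    qPoch (A^2) (q^2) N / qPoch (q^2) (q^2) N := by
  set c : ℕ → ℂ := fun k => qPoch A q k / qPoch q q k with hc
  have hne : ∀ m : ℕ, (1 - q * q ^ m) ≠ 0 := by
    intro m h0
    apply hroot (m+1) (by omega)
    rw [pow_succ]; linear_combination -h0
  have hP : ∀ m, qPoch q q m ≠ 0 := fun m => Finset.prod_ne_zero_iff.mpr fun j _ => hne j
  have hrec : ∀ k, c (k+1) * (1 - q * q ^ k) = c k * (1 - A * q ^ k) := by
    intro k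
    simp only [hc, qP_succ]
    rw [mul_div_mul_comm, mul_assoc, div_mul_cancel₀ _ (hne k)]
  let F : PowerSeries ℂ := PowerSeries.mk c
  have hF : F * (1 - X) = (1 - PowerSeries.C A * X) * rescale q F := by
    ext n
    rw [sub_mul, mul_sub, mul_assoc, one_mul, mul_one, map_sub, map_sub, coeff_C_mul]
    cases n with
    | zero => simp
    | succ k =>
      rw [coeff_succ_mul_X, coeff_succ_X_mul, coeff_rescale, coeff_rescale]
      simp only [F, coeff_mk]
      linear_combination hrec k
  let G : PowerSeries ℂ := rescale (-1) F * F
  have hX (a : ℂ) : rescale a (X : PowerSeries ℂ) = PowerSeries.C a * X := by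
    exact rescale_X a
  have hCC (a b : ℂ) : rescale a (PowerSeries.C b : PowerSeries ℂ) = PowerSeries.C b := by
    ext n
    rw [coeff_rescale, coeff_C]
    split_ifs with h <;> simp [h]
  have hF2 := congrArg (rescale (-1 : ℂ)) hF
  simp only [map_mul, map_sub, map_one, hX, hCC, map_neg, rescale_rescale] at hF2
  have hG : G * (1 - X ^ 2) = (1 - PowerSeries.C (A^2) * X ^ 2) * rescale q G := by
    simp only [G, map_mul, rescale_rescale, map_pow]
    rw [show (-1 : ℂ) * q = q * -1 by ring] at *
    have h3 := congrArg₂ (· * ·) hF2 hF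
    linear_combination h3
  have hGrec : ∀ k, coeff (k+2) G * (1 - q * q ^ (k+1)) = coeff k G * (1 - A^2 * q ^ k) := by
    intro k
    have := congrArg (coeff (k+2)) hG
    clear_value G
    rw [sub_mul, mul_sub, mul_assoc, one_mul, mul_one, map_sub, map_sub, coeff_C_mul,
      coeff_mul_X_pow, coeff_X_pow_mul, coeff_rescale, coeff_rescale] at this
    linear_combination this
  have hfin : ∀ N, coeff (2 * N) G = qPoch (A^2) (q^2) N / qPoch (q^2) (q^2) N := by
    intro N
    induction N with
    | zero => simp [G, F, qP_zero, hc, coeff_mul, coeff_rescale, -coeff_zero_eq_constantCoeff]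
    | succ N ih =>
      have h1 := hGrec (2 * N)
      have h2 := hne (2 * N + 1)
      rw [ih] at h1
      rw [qP_succ, qP_succ, mul_add, mul_one, mul_div_mul_comm, ← pow_mul]
      rw [show q * q ^ (2 * N + 1) = q ^ 2 * q ^ (2 * N) by ring] at h1 h2
      rw [← mul_div_assoc, eq_div_iff h2]
      exact h1
  rw [← hfin]
  simp only [G, F, coeff_mul, coeff_rescale, coeff_mk]
  rw [Finset.Nat.sum_antidiagonal_eq_sum_range_succ_mk]

theorem stmt_3 (q : ℂ) (M N : ℕ) (hq : ‖q‖ < 1) (hq0 : q ≠ 0)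
    (hroot : ∀ n : ℕ, 0 < n → q ^ n ≠ 1) :
    ∑ i ∈ Finset.range (2 * N + 1),
        qPoch (q ^ (M + 2)) q i * qPoch (q ^ (-2 * (N : ℤ))) q i /
          (qPoch q q i * qPoch (q ^ (-(2 * (N : ℤ) + M + 1))) q i) *
          (-(q ^ (-((M : ℤ) + 1)))) ^ i =
      qPoch (-(q ^ (M + 2))) q N * qPoch q (q ^ 2) N / qPoch (q ^ (M + N + 2)) q N := by
  have hne : ∀ k m : ℕ, (1 - q ^ (k + 1) * q ^ m) ≠ 0 := by
    intro k m h0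
    apply hroot (k + 1 + m) (by omega)
    rw [pow_add]; linear_combination -h0
  have hP : ∀ k m, qPoch (q ^ (k+1)) q m ≠ 0 :=
    fun k m => Finset.prod_ne_zero_iff.mpr fun j _ => hne k j
  have hP1 : ∀ m, qPoch q q m ≠ 0 := fun m => by simpa using hP 0 m
  have hPA : ∀ m, qPoch (q ^ (M+2)) q m ≠ 0 := fun m => hP (M+1) m
  have hP2 : qPoch (q ^ 2) (q ^ 2) N ≠ 0 := by
    intro h
    have := hP1 (2 * N)
    rw [qP_two, h, mul_zero] at this
    exact this rfl
  have hPC : ∀ i, i ≤ 2 * N → qPoch (q ^ (-(2 * (N : ℤ) + M + 1))) q i ≠ 0 := by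
    intro i hi
    refine Finset.prod_ne_zero_iff.mpr fun j hj h0 => ?_
    rw [Finset.mem_range] at hj
    apply hroot (2 * N + M + 1 - j) (by omega)
    have h1 : q ^ (-(2 * (N : ℤ) + M + 1)) * q ^ j = 1 := by linear_combination -h0
    have h2 : q ^ (2 * N + M + 1) = q ^ j := by
      rw [zpow_neg, show (2 * (N : ℤ) + M + 1) = ((2 * N + M + 1 : ℕ) : ℤ) by push_cast; ring,
        zpow_natCast] at h1
      have : q ^ (2 * N + M + 1) ≠ 0 := pow_ne_zero _ hq0
      field_simp at h1
      exact h1.symm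
    rw [pow_sub₀ _ hq0 (by omega), h2, mul_inv_cancel₀ (pow_ne_zero _ hq0)]
  have hterm : ∀ i ∈ Finset.range (2 * N + 1),
      qPoch (q ^ (M + 2)) q i * qPoch (q ^ (-2 * (N : ℤ))) q i /
          (qPoch q q i * qPoch (q ^ (-(2 * (N : ℤ) + M + 1))) q i) *
          (-(q ^ (-((M : ℤ) + 1)))) ^ i =
      qPoch q q (2 * N) / qPoch (q ^ (M+2)) q (2 * N) *
       ((-1) ^ i * (qPoch (q ^ (M+2)) q i / qPoch q q i) *
      (qPoch (q ^ (M+2)) q (2 * N - i) / qPoch q q (2 * N - i))) := by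
    intro i hi
    rw [Finset.mem_range] at hi
    have := qP_term q (q ^ (M+2)) (q ^ (-2 * (N : ℤ))) (q ^ (-(2 * (N : ℤ) + M + 1)))
      (-(q ^ (-((M : ℤ) + 1)))) (2 * N) hq0 (pow_ne_zero _ hq0) hroot
      (by
        rw [← zpow_natCast, ← zpow_add₀ hq0]
        simp)
      (by
        rw [← zpow_natCast, ← zpow_natCast, ← zpow_add₀ hq0, ← zpow_add₀ hq0]
        conv_rhs => rw [← zpow_one q]
        congr 1
        push_cast; ring)
      (by
        rw [← zpow_natCast, neg_mul, ← zpow_add₀ hq0]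
        conv_rhs => rw [← zpow_one q]
        congr 2
        push_cast; ring) i (2 * N - i) (by omega)
    have a1 := hPC i (by omega)
    have a2 := hP1 i
    have a3 := hP1 (2 * N - i)
    have a4 := hPA (2 * N)
    generalize (-(q ^ (-((M : ℤ) + 1)))) ^ i = X at *
    generalize qPoch (q ^ (-(2 * (N : ℤ) + M + 1))) q i = Y at *
    generalize qPoch (q ^ (-2 * (N : ℤ))) q i = Z at *
    generalize ((-1 : ℂ)) ^ i = W at *
    rw [← mul_div_assoc, ← mul_div_assoc, div_mul_eq_mul_div, div_mul_eq_mul_div, ← mul_div_assoc,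
      div_eq_div_iff (mul_ne_zero a2 a1) (by positivity)]
    field_simp
    linear_combination qPoch (q ^ (M+2)) q i * this
  rw [Finset.sum_congr rfl hterm, ← Finset.mul_sum, qP_conv q _ hroot, qP_sq, qP_two,
    two_mul, qP_add (q ^ (M+2)), ← pow_add, show M + 2 + N = M + N + 2 by ring]
  have a1 := hPA N
  have a2 : qPoch (q ^ (M + N + 2)) q N ≠ 0 := hP (M+N+1) N
  field_simp
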